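/- arXiv:1811.02437 — 3 statements merged into one kernel-verified Lean document; each statement's English description precedes it below -/
import Mathlib

section
/- Let α, β be the operators on V^⊗(2p−1) defined in the context. Then α∘α = 0 and β∘β = 0. -/
noncomputable section

/-- The quantum integer `[n] = (q^n - q^{-n})/(q - q⁻¹)`. -/
def qint (q : ℂ) (n : ℤ) : ℂ := (q ^ n - q ^ (-n)) / (q - q⁻¹)

/-- The quantum factorial `[n]! = [1][2]⋯[n]`, with `[0]! = 1`. -/
def qfact (q : ℂ) (n : ℕ) : ℂ := ∏ m ∈ Finset.range n, qint q ((m : ℤ) + 1)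

/-- Binary strings of length `z`, indexing the standard basis of `V^{⊗z}` for `V = ℂ²`:
value `1` at a position means `ν₁` there, value `0` means `ν₀`. -/
abbrev Str (z : ℕ) := Fin z → Fin 2

/-- `V^{⊗z}`, modelled by coordinates with respect to the standard basis of tensors of
`ν₀`'s and `ν₁`'s. -/
abbrev Vz (z : ℕ) := Str z → ℂ

/-- The basis vector `ρ_{i₁,…,i_k,z}` of `V^{⊗z}` having `ν₁` exactly at the positions in `S`
and `ν₀` elsewhere. -/
def rho (z : ℕ) (S : Finset (Fin z)) : Vz z :=
  fun t => if t = (fun j => if j ∈ S then 1 else 0) then 1 else 0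

/-- `x_{0,z} = ν₀^{⊗z}`. -/
def x0 (z : ℕ) : Vz z := rho z ∅

/-- `x_{z,z} = ν₁^{⊗z}`. -/
def xtop (z : ℕ) : Vz z := rho z Finset.univ

/-- The set of positions of a basis string carrying `ν₁`. -/
def onesOf {z : ℕ} (s : Str z) : Finset (Fin z) := Finset.univ.filter fun j => s j = 1

/-- `i₁ + ⋯ + i_k`, the sum of the (1-indexed) positions in `S`. -/
def posSum {z : ℕ} (S : Finset (Fin z)) : ℤ := ∑ j ∈ S, (((j : ℕ) : ℤ) + 1)

/-- The `K`-weight exponent of a basis vector of `V`: `Kν₀ = qν₀`, `Kν₁ = q⁻¹ν₁`. -/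
def kwt (v : Fin 2) : ℤ := if v = 0 then 1 else -1

/-- Matrix of `E_z = Σᵢ 1^{⊗(i-1)} ⊗ E ⊗ K^{⊗(z-i)}` on `V^{⊗z}`. -/
def Emat (q : ℂ) (z : ℕ) : Matrix (Str z) (Str z) ℂ := fun t s =>
  ∑ i : Fin z,
    if s i = 1 ∧ t = Function.update s i 0 then
      q ^ (∑ j ∈ Finset.univ.filter (fun j => i < j), kwt (s j)) else 0

/-- Matrix of `F_z = Σᵢ (K⁻¹)^{⊗(i-1)} ⊗ F ⊗ 1^{⊗(z-i)}` on `V^{⊗z}`. -/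
def Fmat (q : ℂ) (z : ℕ) : Matrix (Str z) (Str z) ℂ := fun t s =>
  ∑ i : Fin z,
    if s i = 0 ∧ t = Function.update s i 1 then
      q ^ (-∑ j ∈ Finset.univ.filter (fun j => j < i), kwt (s j)) else 0

/-- `E_z` as a linear operator on `V^{⊗z}`. -/
def EOp (q : ℂ) (z : ℕ) : Module.End ℂ (Vz z) := (Emat q z).mulVecLin

/-- `F_z` as a linear operator on `V^{⊗z}`. -/
def FOp (q : ℂ) (z : ℕ) : Module.End ℂ (Vz z) := (Fmat q z).mulVecLin

/-- Matrix of the map `α : V^{⊗(2p-1)} → V^{⊗(2p-1)}`, with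
`α(ρ_{i₁,…,i_k,2p-1}) = q^{k(2p-1) - (k²-k)/2 - Σᵢ iⱼ}·[k]!·E_{2p-1}^{p-k-1} x_{2p-1,2p-1}`
for `k ≤ p-1`, and `α(ρ_{i₁,…,i_k,2p-1}) = 0` for `k ≥ p`. -/
def alphaMat (q : ℂ) (p : ℕ) : Matrix (Str (2 * p - 1)) (Str (2 * p - 1)) ℂ := fun t s =>
  let k := (onesOf s).card
  if k < p then
    (q ^ ((k : ℤ) * ((2 * p - 1 : ℕ) : ℤ) - ((k : ℤ) ^ 2 - (k : ℤ)) / 2 - posSum (onesOf s))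
        * qfact q k)
      * ((EOp q (2 * p - 1) ^ (p - 1 - k)) (xtop (2 * p - 1)) t)
  else 0

/-- Matrix of the map `β : V^{⊗(2p-1)} → V^{⊗(2p-1)}`, with
`β(ρ_{i₁,…,i_k,2p-1}) = q^{k(2p-1) - (k²-k)/2 - Σᵢ iⱼ}·[2p-1-k]!·F_{2p-1}^{k-p} x_{0,2p-1}`
for `k ≥ p`, and `β(ρ_{i₁,…,i_k,2p-1}) = 0` for `k ≤ p-1`. -/
def betaMat (q : ℂ) (p : ℕ) : Matrix (Str (2 * p - 1)) (Str (2 * p - 1)) ℂ := fun t s =>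
  let k := (onesOf s).card
  if p ≤ k then
    (q ^ ((k : ℤ) * ((2 * p - 1 : ℕ) : ℤ) - ((k : ℤ) ^ 2 - (k : ℤ)) / 2 - posSum (onesOf s))
        * qfact q (2 * p - 1 - k))
      * ((FOp q (2 * p - 1) ^ (k - p)) (x0 (2 * p - 1)) t)
  else 0

/-- The operator `α` on `V^{⊗(2p-1)}`. -/
def alphaOp (q : ℂ) (p : ℕ) : Module.End ℂ (Vz (2 * p - 1)) := (alphaMat q p).mulVecLin

/-- The operator `β` on `V^{⊗(2p-1)}`. -/
def betaOp (q : ℂ) (p : ℕ) : Module.End ℂ (Vz (2 * p - 1)) := (betaMat q p).mulVecLin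

/-- `1^{⊗a} ⊗ M ⊗ 1^{⊗(n-a-c)}`: the amplification of a matrix `M` acting on `c` tensor
factors to `V^{⊗n}`, placed on the factor positions `a+1, …, a+c` (1-indexed). -/
def ampMat (n a c : ℕ) (h : a + c ≤ n) (M : Matrix (Str c) (Str c) ℂ) :
    Matrix (Str n) (Str n) ℂ := fun t s =>
  if ∀ j : Fin n, ((j : ℕ) < a ∨ a + c ≤ (j : ℕ)) → t j = s j then
    M (fun j => t ⟨a + (j : ℕ), by have := j.isLt; omega⟩)
      (fun j => s ⟨a + (j : ℕ), by have := j.isLt; omega⟩)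
  else 0

/-- `α_i = 1^{⊗(i-1)} ⊗ α ⊗ 1^{⊗(n-2p+2-i)}` on `V^{⊗n}` (with `i` 1-indexed). -/
def alphaOpAt (q : ℂ) (p n i : ℕ) (h : (i - 1) + (2 * p - 1) ≤ n) : Module.End ℂ (Vz n) :=
  (ampMat n (i - 1) (2 * p - 1) h (alphaMat q p)).mulVecLin

/-- `β_i = 1^{⊗(i-1)} ⊗ β ⊗ 1^{⊗(n-2p+2-i)}` on `V^{⊗n}` (with `i` 1-indexed). -/
def betaOpAt (q : ℂ) (p n i : ℕ) (h : (i - 1) + (2 * p - 1) ≤ n) : Module.End ℂ (Vz n) :=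
  (ampMat n (i - 1) (2 * p - 1) h (betaMat q p)).mulVecLin

/-- Matrix of `∪` applied at the (0-indexed) positions `i, i+1` of `N = M + 2` strands:
`∪(ν₀⊗ν₀) = ∪(ν₁⊗ν₁) = 0`, `∪(ν₁⊗ν₀) = 1`, `∪(ν₀⊗ν₁) = -q`. -/
def cupMat (q : ℂ) (N M i : ℕ) (h : N = M + 2) (hi : i + 1 < N) :
    Matrix (Str M) (Str N) ℂ := fun t s =>
  if ∀ j : Fin M,
      t j = s ⟨if (j : ℕ) < i then (j : ℕ) else (j : ℕ) + 2, by
        have := j.isLt; split <;> omega⟩ then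
    (if s ⟨i, by omega⟩ = 1 ∧ s ⟨i + 1, hi⟩ = 0 then 1
     else if s ⟨i, by omega⟩ = 0 ∧ s ⟨i + 1, hi⟩ = 1 then -q
     else 0)
  else 0

/-- Matrix of `∩` inserted at the (0-indexed) positions `i, i+1` of `N = M + 2` strands:
`∩(1) = q⁻¹ ν₁⊗ν₀ - ν₀⊗ν₁`. -/
def capMat (q : ℂ) (N M i : ℕ) (h : N = M + 2) (hi : i + 1 < N) :
    Matrix (Str N) (Str M) ℂ := fun t s =>
  if ∀ j : Fin M,
      s j = t ⟨if (j : ℕ) < i then (j : ℕ) else (j : ℕ) + 2, by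
        have := j.isLt; split <;> omega⟩ then
    (if t ⟨i, by omega⟩ = 1 ∧ t ⟨i + 1, hi⟩ = 0 then q⁻¹
     else if t ⟨i, by omega⟩ = 0 ∧ t ⟨i + 1, hi⟩ = 1 then -1
     else 0)
  else 0

/-- `∪_{i+1} : V^{⊗N} → V^{⊗M}`, `N = M + 2` (here `i` is the 0-indexed position). -/
def cupOp (q : ℂ) (N M i : ℕ) (h : N = M + 2) (hi : i + 1 < N) : Vz N →ₗ[ℂ] Vz M :=
  (cupMat q N M i h hi).mulVecLin

/-- `∩_{i+1} : V^{⊗M} → V^{⊗N}`, `N = M + 2` (here `i` is the 0-indexed position). -/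
def capOp (q : ℂ) (N M i : ℕ) (h : N = M + 2) (hi : i + 1 < N) : Vz M →ₗ[ℂ] Vz N :=
  (capMat q N M i h hi).mulVecLin

/-- Matrix of the Jones–Wenzl-type map `G_n` on `V^{⊗n}`:
`G_n(ρ_{i₁,…,i_k,n}) = q^{kn - (k²-k)/2 - Σ iⱼ}·([n-k]!/[n]!)·F_n^k x_{0,n}`. -/
def jwMat (q : ℂ) (n : ℕ) : Matrix (Str n) (Str n) ℂ := fun t s =>
  let k := (onesOf s).card
  (q ^ ((k : ℤ) * (n : ℤ) - ((k : ℤ) ^ 2 - (k : ℤ)) / 2 - posSum (onesOf s))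
      * (qfact q (n - k) / qfact q n))
    * ((FOp q n ^ k) (x0 n) t)

/-- The Jones–Wenzl-type map `G_n` on `V^{⊗n}`. -/
def jwOp (q : ℂ) (n : ℕ) : Module.End ℂ (Vz n) := (jwMat q n).mulVecLin

/-- `v ⊗ ν_a : V^{⊗z} ⊗ V → V^{⊗(z+1)}` (appending a basis vector of `V` on the right). -/
def appendR {z : ℕ} (v : Vz z) (a : Fin 2) : Vz (z + 1) :=
  fun t => if t (Fin.last z) = a then v (fun j => t j.castSucc) else 0

/-- `ν_a ⊗ v : V ⊗ V^{⊗z} → V^{⊗(z+1)}` (appending a basis vector of `V` on the left). -/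
def appendL {z : ℕ} (a : Fin 2) (v : Vz z) : Vz (z + 1) :=
  fun t => if t 0 = a then v (fun j => t j.succ) else 0

/-- `ξ_{n,z} = Σ_{1 ≤ i₁ < ⋯ < i_n ≤ z} q^{-2(i₁+⋯+i_n)}`. -/
def xiSum (q : ℂ) (n z : ℕ) : ℂ :=
  ∑ S ∈ Finset.powersetCard n (Finset.univ : Finset (Fin z)), q ^ (-2 * posSum S)

lemma onesOf_update_zero {z : ℕ} (s : Str z) (i : Fin z) :
    onesOf (Function.update s i 0) = (onesOf s).erase i := by
  ext j
  by_cases h : j = i <;> simp [onesOf, Function.update_apply, h]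

lemma onesOf_update_one {z : ℕ} (s : Str z) (i : Fin z) :
    onesOf (Function.update s i 1) = insert i (onesOf s) := by
  ext j
  by_cases h : j = i <;> simp [onesOf, Function.update_apply, h]

lemma card_onesOf_of_Emat_ne_zero {q : ℂ} {z : ℕ} {t s : Str z} (h : Emat q z t s ≠ 0) :
    (onesOf t).card + 1 = (onesOf s).card := by
  obtain ⟨i, -, hi⟩ := Finset.exists_ne_zero_of_sum_ne_zero h
  obtain ⟨⟨hs, rfl⟩, -⟩ := ite_ne_right_iff.mp hi
  rw [onesOf_update_zero]
  exact Finset.card_erase_add_one (by simp [onesOf, hs])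

lemma card_onesOf_of_Fmat_ne_zero {q : ℂ} {z : ℕ} {t s : Str z} (h : Fmat q z t s ≠ 0) :
    (onesOf t).card = (onesOf s).card + 1 := by
  obtain ⟨i, -, hi⟩ := Finset.exists_ne_zero_of_sum_ne_zero h
  obtain ⟨⟨hs, rfl⟩, -⟩ := ite_ne_right_iff.mp hi
  rw [onesOf_update_one]
  exact Finset.card_insert_of_notMem (by simp [onesOf, hs])

lemma card_onesOf_of_EOp_pow_xtop_ne_zero {q : ℂ} {z : ℕ} (m : ℕ) {t : Str z}
    (h : (EOp q z ^ m) (xtop z) t ≠ 0) : (onesOf t).card + m = z := by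
  induction m generalizing t with
  | zero =>
    obtain ⟨rfl, -⟩ := ite_ne_right_iff.mp h
    simp [onesOf]
  | succ m ih =>
    rw [pow_succ', Module.End.mul_apply] at h
    obtain ⟨s, -, hs⟩ := Finset.exists_ne_zero_of_sum_ne_zero h
    have hE := card_onesOf_of_Emat_ne_zero (left_ne_zero_of_mul hs)
    have hm := ih (right_ne_zero_of_mul hs)
    omega

lemma card_onesOf_of_FOp_pow_x0_ne_zero {q : ℂ} {z : ℕ} (m : ℕ) {t : Str z}
    (h : (FOp q z ^ m) (x0 z) t ≠ 0) : (onesOf t).card = m := by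
  induction m generalizing t with
  | zero =>
    obtain ⟨rfl, -⟩ := ite_ne_right_iff.mp h
    simp [onesOf]
  | succ m ih =>
    rw [pow_succ', Module.End.mul_apply] at h
    obtain ⟨s, -, hs⟩ := Finset.exists_ne_zero_of_sum_ne_zero h
    have hF := card_onesOf_of_Fmat_ne_zero (left_ne_zero_of_mul hs)
    have hm := ih (right_ne_zero_of_mul hs)
    omega

lemma card_onesOf_of_alphaMat_ne_zero {q : ℂ} {p : ℕ} {t s : Str (2 * p - 1)}
    (h : alphaMat q p t s ≠ 0) : (onesOf s).card < p ∧ p ≤ (onesOf t).card := by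
  obtain ⟨hk, h⟩ := ite_ne_right_iff.mp h
  have := card_onesOf_of_EOp_pow_xtop_ne_zero _ (right_ne_zero_of_mul h)
  exact ⟨hk, by omega⟩

lemma card_onesOf_of_betaMat_ne_zero {q : ℂ} {p : ℕ} (hp : 0 < p) {t s : Str (2 * p - 1)}
    (h : betaMat q p t s ≠ 0) : p ≤ (onesOf s).card ∧ (onesOf t).card < p := by
  obtain ⟨hk, h⟩ := ite_ne_right_iff.mp h
  have ht := card_onesOf_of_FOp_pow_x0_ne_zero _ (right_ne_zero_of_mul h)
  have hs : (onesOf s).card ≤ 2 * p - 1 := by simpa using Finset.card_le_univ (onesOf s)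
  exact ⟨hk, by omega⟩

lemma alphaMat_mul_self (q : ℂ) (p : ℕ) : alphaMat q p * alphaMat q p = 0 := by
  ext t s
  refine Finset.sum_eq_zero fun u _ => ?_
  by_contra h
  have h₁ := card_onesOf_of_alphaMat_ne_zero (left_ne_zero_of_mul h)
  have h₂ := card_onesOf_of_alphaMat_ne_zero (right_ne_zero_of_mul h)
  omega

lemma betaMat_mul_self (q : ℂ) {p : ℕ} (hp : 0 < p) : betaMat q p * betaMat q p = 0 := by
  ext t s
  refine Finset.sum_eq_zero fun u _ => ?_
  by_contra h
  have h₁ := card_onesOf_of_betaMat_ne_zero hp (left_ne_zero_of_mul h)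
  have h₂ := card_onesOf_of_betaMat_ne_zero hp (right_ne_zero_of_mul h)
  omega

/-- `α∘α = 0` and `β∘β = 0` on `V^{⊗(2p-1)}`. -/
theorem stmt0 (p : ℕ) (hp : 2 ≤ p) (q : ℂ)
    (hq : q = Complex.exp (Real.pi * Complex.I / p)) :
    alphaOp q p ∘ₗ alphaOp q p = 0 ∧ betaOp q p ∘ₗ betaOp q p = 0 := by
  constructor
  · rw [alphaOp, ← Matrix.mulVecLin_mul, alphaMat_mul_self, Matrix.mulVecLin_zero]
  · rw [betaOp, ← Matrix.mulVecLin_mul, betaMat_mul_self q (by omega), Matrix.mulVecLin_zero]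

end
end

section
/- Let n ≥ 2p−1 and let α_i, β_i be the operators on V^⊗n defined in the context. For all i ≥ 1 with i+p ≤ n−2p+2, one has α_i∘α_{i+p} = α_{i+p}∘α_i and β_i∘β_{i+p} = β_{i+p}∘β_i. -/
noncomputable section

/-- Closed form for the powers of an operator flipping one letter of a basis string at a time,
with the `q`-weights occurring in `Emat` and `Fmat`, applied to the constant string. -/
lemma pow_flip_apply {z : ℕ} {q : ℂ} (hq : q ≠ 0) {e e' : Fin 2} (he : e ≠ e')
    (d : Fin z → ℤ) (r : Fin z → Fin z → Prop) [DecidableRel r] (hirr : ∀ i, ¬ r i i)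
    (hr : ∀ Z : Finset (Fin z), ∑ i ∈ Z, q ^ (2 * (Z.filter (r · i)).card) =
      ∑ l ∈ Finset.range Z.card, q ^ (2 * l))
    (A : Matrix (Str z) (Str z) ℂ)
    (hA : ∀ t s, A t s = ∑ i, if s i = e ∧ t = Function.update s i e' then
      q ^ (d i) * q ^ (2 * (Finset.univ.filter fun j => s j = e' ∧ r j i).card) else 0)
    (v : Vz z) (hv : ∀ t, v t = if (Finset.univ.filter fun j => t j = e').card = 0 then 1 else 0)
    (m : ℕ) (t : Str z) :
    (A.mulVecLin ^ m) v t = if (Finset.univ.filter fun j => t j = e').card = m then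
      (∏ l ∈ Finset.range m, ∑ i ∈ Finset.range (l + 1), q ^ (2 * i)) *
        q ^ (∑ j with t j = e', d j) else 0 := by
  induction m generalizing t with
  | zero =>
    simp only [pow_zero, Module.End.one_apply, hv]
    split_ifs with h
    · rw [Finset.card_eq_zero] at h
      simp [h]
    · rfl
  | succ m ih =>
    have key : (A.mulVecLin ^ (m + 1)) v t = ∑ i, if t i = e' then
        q ^ (d i) * q ^ (2 * (Finset.univ.filter fun j => t j = e' ∧ r j i).card) *
          (A.mulVecLin ^ m) v (Function.update t i e) else 0 := by
      rw [pow_succ', Module.End.mul_apply, Matrix.mulVecLin_apply]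
      simp only [Matrix.mulVec, dotProduct, hA, Finset.sum_mul]
      rw [Finset.sum_comm]
      refine Finset.sum_congr rfl fun i _ => ?_
      rw [Finset.sum_eq_single (Function.update t i e)]
      · by_cases hti : t i = e'
        · rw [if_pos ⟨by simp, by rw [← hti]; simp⟩, if_pos hti]
          congr 4
          congr 1
          ext j
          simp only [Finset.mem_filter, Finset.mem_univ, true_and]
          by_cases hj : j = i
          · subst hj; simp [hirr]
          · simp [hj]
        · rw [if_neg hti, if_neg, zero_mul]
          rintro ⟨-, h⟩
          exact hti (by rw [h]; simp)
      · intro s _ hs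
        rw [if_neg, zero_mul]
        rintro ⟨h1, rfl⟩
        exact hs (by rw [← h1]; simp)
      · simp
    have hset : ∀ i, t i = e' → (Finset.univ.filter fun j => Function.update t i e j = e')
        = (Finset.univ.filter fun j => t j = e').erase i := by
      intro i hi
      ext j
      by_cases hj : j = i
      · subst hj; simp [he]
      · simp [hj]
    set Z := Finset.univ.filter fun j => t j = e' with hZ
    rw [key, ← Finset.sum_filter, ← hZ]
    have hterm : ∀ i ∈ Z, q ^ (d i) * q ^ (2 * (Finset.univ.filter fun j => t j = e' ∧ r j i).card) *
          (A.mulVecLin ^ m) v (Function.update t i e) = if Z.card = m + 1 then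
          ((∏ l ∈ Finset.range m, ∑ i ∈ Finset.range (l + 1), q ^ (2 * i)) *
        q ^ (∑ j ∈ Z, d j)) * q ^ (2 * (Z.filter (r · i)).card) else 0 := by
      intro i hi
      have hi' : t i = e' := by simpa [hZ] using hi
      have hc := Finset.card_erase_add_one hi
      rw [ih, hset i hi', hZ, Finset.filter_filter, ← hZ]
      by_cases h : Z.card = m + 1
      · rw [if_pos h, if_pos (by omega), ← Finset.add_sum_erase Z d hi, zpow_add₀ hq]
        ring
      · rw [if_neg h, if_neg (by omega), mul_zero]
    rw [Finset.sum_congr rfl hterm]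
    split_ifs with h
    · rw [← Finset.mul_sum, hr, h, Finset.prod_range_succ]
      ring
    · simp

lemma sum_card_filter_gt {z : ℕ} {M : Type*} [AddCommMonoid M] (f : ℕ → M) (Z : Finset (Fin z)) :
    ∑ i ∈ Z, f (Z.filter (i < ·)).card = ∑ l ∈ Finset.range Z.card, f l := by
  induction Z using Finset.induction_on_min with
  | empty => simp
  | insert a s h ih =>
    have ha : a ∉ s := fun h' => lt_irrefl _ (h a h')
    rw [Finset.sum_insert ha, Finset.card_insert_of_notMem ha, Finset.sum_range_succ, ← ih, add_comm]
    congr 1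
    · refine Finset.sum_congr rfl fun i hi => ?_
      rw [Finset.filter_insert, if_neg (h i hi).not_gt]
    · rw [Finset.filter_insert, if_neg (lt_irrefl _), Finset.filter_true_of_mem h]

lemma sum_card_filter_lt {z : ℕ} {M : Type*} [AddCommMonoid M] (f : ℕ → M) (Z : Finset (Fin z)) :
    ∑ i ∈ Z, f (Z.filter (· < i)).card = ∑ l ∈ Finset.range Z.card, f l := by
  induction Z using Finset.induction_on_max with
  | empty => simp
  | insert a s h ih =>
    have ha : a ∉ s := fun h' => lt_irrefl _ (h a h')
    rw [Finset.sum_insert ha, Finset.card_insert_of_notMem ha, Finset.sum_range_succ, ← ih, add_comm]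
    congr 1
    · refine Finset.sum_congr rfl fun i hi => ?_
      rw [Finset.filter_insert, if_neg (h i hi).not_gt]
    · rw [Finset.filter_insert, if_neg (lt_irrefl _), Finset.filter_true_of_mem h]

lemma sum_kwt {z : ℕ} (s : Str z) (S : Finset (Fin z)) (e : Fin 2) :
    ∑ j ∈ S, kwt (s j) = kwt (1 - e) * (S.card - 2 * (S.filter fun j => s j = e).card) := by
  have : ∀ j, kwt (s j) = kwt (1 - e) * (1 - 2 * if s j = e then 1 else 0) := by
    intro j
    generalize s j = x
    revert x e
    decide
  simp only [this, ← Finset.mul_sum, Finset.sum_sub_distrib]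
  simp

lemma prod_sum_eq_qfact {q : ℂ} (hq : q ≠ 0) (hq2 : q - q⁻¹ ≠ 0) (m : ℕ) :
    ∏ l ∈ Finset.range m, ∑ i ∈ Finset.range (l + 1), q ^ (2 * i) =
      q ^ (((m : ℤ) ^ 2 - m) / 2) * qfact q m := by
  have hs : ∀ l : ℕ, ∑ i ∈ Finset.range (l + 1), q ^ (2 * i) = q ^ (l : ℤ) * qint q (l + 1) := by
    intro l
    have h1 : (∑ i ∈ Finset.range (l + 1), q ^ (2 * i)) * (q ^ 2 - 1) = (q ^ 2) ^ (l + 1) - 1 := by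
      simpa only [pow_mul] using geom_sum_mul (q ^ 2) (l + 1)
    have h2 : q ^ 2 - 1 ≠ 0 := by
      intro h
      apply hq2
      field_simp
      simpa using h
    rw [eq_div_of_mul_eq h2 h1, qint, zpow_neg, zpow_add₀ hq, zpow_one, zpow_natCast]
    field_simp
    ring
  induction m with
  | zero => simp [qfact]
  | succ m ih =>
    rw [Finset.prod_range_succ, ih, hs, qfact, qfact, Finset.prod_range_succ]
    have : (((m + 1 : ℕ) : ℤ) ^ 2 - (m + 1 : ℕ)) / 2 = ((m : ℤ) ^ 2 - m) / 2 + m := by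
      push_cast
      rw [show ((m : ℤ) + 1) ^ 2 - (m + 1) = (m : ℤ) ^ 2 - m + m * 2 by ring]
      omega
    rw [this, zpow_add₀ hq]
    ring

lemma EOp_pow_xtop_apply {q : ℂ} (hq : q ≠ 0) (hq2 : q - q⁻¹ ≠ 0) (z m : ℕ) (t : Str z) :
    (EOp q z ^ m) (xtop z) t = if (Finset.univ.filter fun j => t j = 0).card = m then
      q ^ (((m : ℤ) ^ 2 - m) / 2) * qfact q m *
        q ^ (∑ j with t j = 0, (-((z : ℤ) - 1 - (j : ℕ)))) else 0 := by
  rw [← prod_sum_eq_qfact hq hq2]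
  refine pow_flip_apply hq (e := 1) (by decide) _ (fun j i => i < j) (fun i => lt_irrefl i)
    (sum_card_filter_gt (fun l => q ^ (2 * l))) _ ?_ _ ?_ m t
  · intro t s
    refine Finset.sum_congr rfl fun i _ => ?_
    congr 1
    rw [sum_kwt s _ 0, Finset.filter_filter, ← zpow_natCast, ← zpow_add₀ hq]
    congr 1
    have h1 : (Finset.univ.filter fun j => i < j).card = z - 1 - i := by
      have := Fin.card_Ioi i
      rw [← this]; congr 1; ext; simp
    simp only [h1, and_comm, kwt]
    have := i.isLt
    push_cast [Nat.cast_sub (show 1 ≤ z by omega), Nat.cast_sub (show (i : ℕ) ≤ z - 1 by omega)]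
    simp
    ring
  · intro t
    simp only [xtop, rho, Finset.mem_univ, if_true, Finset.card_eq_zero, Finset.filter_eq_empty_iff,
      true_imp_iff, funext_iff]
    congr 1
    refine propext (forall_congr' fun j => ?_)
    generalize t j = x
    revert x
    decide

lemma FOp_pow_x0_apply {q : ℂ} (hq : q ≠ 0) (hq2 : q - q⁻¹ ≠ 0) (z m : ℕ) (t : Str z) :
    (FOp q z ^ m) (x0 z) t = if (Finset.univ.filter fun j => t j = 1).card = m then
      q ^ (((m : ℤ) ^ 2 - m) / 2) * qfact q m *
        q ^ (∑ j with t j = 1, (-((j : ℕ) : ℤ))) else 0 := by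
  rw [← prod_sum_eq_qfact hq hq2]
  refine pow_flip_apply hq (e := 0) (by decide) _ (fun j i => j < i) (fun i => lt_irrefl i)
    (sum_card_filter_lt (fun l => q ^ (2 * l))) _ ?_ _ ?_ m t
  · intro t s
    refine Finset.sum_congr rfl fun i _ => ?_
    congr 1
    rw [sum_kwt s _ 1, Finset.filter_filter, ← zpow_natCast, ← zpow_add₀ hq]
    congr 1
    have h1 : (Finset.univ.filter fun j => j < i).card = i := by
      have := Fin.card_Iio i
      rw [← this]; congr 1; ext; simp
    simp only [h1, and_comm, kwt]
    push_cast
    simp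
    ring
  · intro t
    simp only [x0, rho, Finset.notMem_empty, if_false, Finset.card_eq_zero,
      Finset.filter_eq_empty_iff, Finset.mem_univ, true_imp_iff, funext_iff]
    congr 1
    refine propext (forall_congr' fun j => ?_)
    generalize t j = x
    revert x
    decide

/-- The generating polynomial of the local factor, at position `r` of a window of strands. -/
def localWt (ω : ℂ) (p : ℕ) (e : Fin 2) (r : ℕ) (t s : Fin 2) : Polynomial ℂ :=
  (if s = e then Polynomial.C (ω ^ ((p : ℤ) - 2 - r)) * Polynomial.X else 1) *
    (if t = e then 1 else Polynomial.C (ω ^ (r : ℤ)) * Polynomial.X)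

/-- The matrix whose entries are the coefficients of `X ^ (p - 1)` in products of the polynomials
`localWt`. -/
def coreMat (ω : ℂ) (p : ℕ) (e : Fin 2) (c : ℕ) : Matrix (Str c) (Str c) ℂ := fun t s =>
  (∏ j : Fin c, localWt ω p e j (t j) (s j)).coeff (p - 1)

lemma coreMat_apply {ω : ℂ} (hω : ω ≠ 0) (p : ℕ) (e : Fin 2) (c : ℕ) (t s : Str c) :
    coreMat ω p e c t s =
      if (Finset.univ.filter fun j => s j = e).card +
          (Finset.univ.filter fun j => t j ≠ e).card = p - 1 then
        ω ^ (((p : ℤ) - 2) * (Finset.univ.filter fun j => s j = e).card -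
          ∑ j with s j = e, ((j : ℕ) : ℤ) + ∑ j with t j ≠ e, ((j : ℕ) : ℤ)) else 0 := by
  have hz : ∀ (S : Finset (Fin c)) (g : Fin c → ℤ), ∏ j ∈ S, ω ^ (g j) = ω ^ (∑ j ∈ S, g j) := by
    intro S g
    induction S using Finset.induction_on with
    | empty => simp
    | insert a S ha ih => rw [Finset.prod_insert ha, Finset.sum_insert ha, ih, zpow_add₀ hω]
  have h1 : ∏ j : Fin c, localWt ω p e j (t j) (s j) =
      Polynomial.C (ω ^ (((p : ℤ) - 2) * (Finset.univ.filter fun j => s j = e).card -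
          ∑ j with s j = e, ((j : ℕ) : ℤ) + ∑ j with t j ≠ e, ((j : ℕ) : ℤ))) *
        Polynomial.X ^ ((Finset.univ.filter fun j => s j = e).card +
          (Finset.univ.filter fun j => t j ≠ e).card) := by
    simp only [localWt, Finset.prod_mul_distrib]
    have : ∀ j : Fin c, (if t j = e then (1 : Polynomial ℂ)
        else Polynomial.C (ω ^ ((j : ℕ) : ℤ)) * Polynomial.X) =
        if t j ≠ e then Polynomial.C (ω ^ ((j : ℕ) : ℤ)) * Polynomial.X else 1 := by
      intro j
      split_ifs <;> simp_all
    simp only [this]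
    rw [← Finset.prod_filter, ← Finset.prod_filter, Finset.prod_mul_distrib,
      Finset.prod_mul_distrib, ← map_prod, ← map_prod, hz, hz, zpow_add₀ hω,
      Finset.sum_sub_distrib, map_mul]
    simp only [Finset.prod_const, Finset.sum_const, nsmul_eq_mul, pow_add]
    rw [mul_comm ((p : ℤ) - 2)]
    ring
  rw [coreMat, h1, Polynomial.coeff_C_mul_X_pow]
  simp only [eq_comm]

lemma prod_window {R : Type*} [CommMonoid R] (n a c : ℕ) (h : a + c ≤ n) (f : Fin n → R) :
    ∏ j : Fin n, (if a ≤ (j : ℕ) ∧ (j : ℕ) < a + c then f j else 1) =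
      ∏ r : Fin c, f ⟨a + r, by have := r.isLt; omega⟩ := by
  rw [← Finset.prod_filter]
  symm
  refine Finset.prod_bij (fun r _ => (⟨a + (r : ℕ), by have := r.isLt; omega⟩ : Fin n)) ?_ ?_ ?_ ?_
  · intro r _
    have := r.isLt
    simp
  · intro r _ r' _ hrr
    simp only [Fin.mk.injEq] at hrr
    ext; omega
  · intro j hj
    simp only [Finset.mem_filter, Finset.mem_univ, true_and] at hj
    exact ⟨⟨(j : ℕ) - a, by omega⟩, Finset.mem_univ _, by ext; simp; omega⟩
  · intro r _
    rfl

/-- The local factor, at position `j`, of the amplification of `coreMat` to the window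
`a, …, a + c - 1`. -/
def ampWt (ω : ℂ) (p : ℕ) (e : Fin 2) (a c j : ℕ) (t s : Fin 2) : Polynomial ℂ :=
  if a ≤ j ∧ j < a + c then localWt ω p e (j - a) t s else if t = s then 1 else 0

lemma ampMat_coreMat_apply (ω : ℂ) (p : ℕ) (e : Fin 2) (n a c : ℕ) (h : a + c ≤ n) (t s : Str n) :
    ampMat n a c h (coreMat ω p e c) t s =
      (∏ j : Fin n, ampWt ω p e a c j (t j) (s j)).coeff (p - 1) := by
  rw [ampMat]
  split_ifs with ho
  · have : ∀ j : Fin n, ampWt ω p e a c j (t j) (s j) = if a ≤ (j : ℕ) ∧ (j : ℕ) < a + c then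
        localWt ω p e (j - a) (t j) (s j) else 1 := by
      intro j
      rw [ampWt]
      split_ifs with h1 h2
      · rfl
      · rfl
      · exact absurd (ho j (by omega)) h2
    simp only [this]
    rw [prod_window n a c h (fun j => localWt ω p e (j - a) (t j) (s j)), coreMat]
    simp
  · push Not at ho
    obtain ⟨j, hj, hne⟩ := ho
    rw [Finset.prod_eq_zero (Finset.mem_univ j), Polynomial.coeff_zero]
    rw [ampWt, if_neg (by omega), if_neg hne]

lemma sum_coeff_mul_coeff_prod {n : ℕ} (m : ℕ) (f g : Fin n → Fin 2 → Polynomial ℂ) :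
    ∑ u : Str n, (∏ j, f j (u j)).coeff m * (∏ j, g j (u j)).coeff m =
      ((∏ j, ∑ v, Polynomial.C (f j v) * (g j v).map Polynomial.C).coeff m).coeff m := by
  have h : ∏ j, ∑ v, Polynomial.C (f j v) * (g j v).map Polynomial.C =
      ∑ u : Str n, Polynomial.C (∏ j, f j (u j)) * (∏ j, g j (u j)).map Polynomial.C := by
    rw [Finset.prod_univ_sum, Fintype.piFinset_univ]
    refine Finset.sum_congr rfl fun u _ => ?_
    rw [Finset.prod_mul_distrib, map_prod, Polynomial.map_prod]
  rw [h, Polynomial.finsetSum_coeff, Polynomial.finsetSum_coeff]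
  refine Finset.sum_congr rfl fun u _ => ?_
  rw [Polynomial.coeff_C_mul, Polynomial.coeff_map, Polynomial.coeff_mul_C]

lemma coeff_coeff_eq_zero_of_mem_span {m N : ℕ} (hm : m < N)
    {F : Polynomial (Polynomial ℂ)}
    (hF : F ∈ Ideal.span {(Polynomial.C Polynomial.X : Polynomial (Polynomial ℂ)) ^ N,
      Polynomial.X ^ N}) :
    (F.coeff m).coeff m = 0 := by
  obtain ⟨u, v, rfl⟩ := Ideal.mem_span_pair.1 hF
  rw [← map_pow, Polynomial.coeff_add, Polynomial.coeff_mul_C, Polynomial.coeff_mul_X_pow',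
    if_neg (by omega), add_zero, Polynomial.coeff_mul_X_pow', if_neg (by omega)]

/-- If `ω ^ 2` is a primitive `p`-th root of unity, the product of the linear forms
`ω ^ (-2 - r) x + ω ^ r y` over a complete set of residues lies in the ideal `(x ^ p, y ^ p)`. -/
lemma prod_linear_mem_span {R : Type*} [CommRing R] [IsDomain R] (κ : ℂ →+* R) {ω : ℂ} {p : ℕ}
    (hp : 0 < p) (hω : IsPrimitiveRoot (ω ^ 2) p) (hω0 : ω ≠ 0) (x y : R) :
    ∏ r ∈ Finset.range p, (κ (ω ^ (-2 - (r : ℤ))) * x + κ (ω ^ (r : ℤ)) * y) ∈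
      Ideal.span {x ^ p, y ^ p} := by
  classical
  have hprim := hω.map_of_injective κ.injective
  have h := hprim.pow_sub_pow_eq_prod_sub_mul x (-(κ (ω ^ 2) * y)) hp
  have hprod : ∏ r ∈ Finset.range p, (κ (ω ^ (-2 - (r : ℤ))) * x + κ (ω ^ (r : ℤ)) * y) =
      (∏ r ∈ Finset.range p, κ (ω ^ (-2 - (r : ℤ)))) *
        (x ^ p - (-(κ (ω ^ 2) * y)) ^ p) := by
    rw [h]
    have hinj : Set.InjOn (fun r => κ (ω ^ 2) ^ r) (Finset.range p) := fun i hi j hj hij =>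
      hprim.pow_inj (by simpa using hi) (by simpa using hj) hij
    have himg : Polynomial.nthRootsFinset p (1 : R) =
        (Finset.range p).image (fun r => κ (ω ^ 2) ^ r) := by
      symm
      refine Finset.eq_of_subset_of_card_le ?_ ?_
      · intro w hw
        obtain ⟨r, -, rfl⟩ := Finset.mem_image.1 hw
        rw [Polynomial.mem_nthRootsFinset hp, ← pow_mul, mul_comm, pow_mul, hprim.pow_eq_one,
          one_pow]
      · rw [hprim.card_nthRootsFinset, Finset.card_image_of_injOn hinj, Finset.card_range]
    rw [himg, Finset.prod_image hinj, ← Finset.prod_mul_distrib]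
    refine Finset.prod_congr rfl fun r _ => ?_
    rw [mul_sub, mul_neg, mul_neg, sub_neg_eq_add, ← map_pow, ← mul_assoc, ← mul_assoc,
      ← map_mul, ← map_mul]
    congr 3
    rw [← pow_mul, ← zpow_natCast, ← zpow_natCast, ← zpow_add₀ hω0, ← zpow_add₀ hω0]
    congr 1
    push_cast
    ring
  rw [hprod, neg_pow, mul_pow]
  refine Ideal.mul_mem_left _ _ (Ideal.sub_mem _ (Ideal.subset_span (by simp)) ?_)
  rw [← mul_assoc]
  exact Ideal.mul_mem_left _ _ (Ideal.subset_span (by simp))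

lemma localWt_eq {ω : ℂ} {p : ℕ} (hω0 : ω ≠ 0) (hωp : ω ^ p = -1) (e : Fin 2) (r : ℕ)
    (t s : Fin 2) : localWt ω p e r t s =
      (if s = e then -(Polynomial.C (ω ^ (-2 - (r : ℤ))) * Polynomial.X) else 1) *
        (if t = e then 1 else Polynomial.C (ω ^ (r : ℤ)) * Polynomial.X) := by
  have : ω ^ ((p : ℤ) - 2 - r) = -(ω ^ (-2 - (r : ℤ))) := by
    rw [show (p : ℤ) - 2 - r = p + (-2 - r) by ring, zpow_add₀ hω0, zpow_natCast, hωp, neg_one_mul]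
  rw [localWt, this, map_neg, neg_mul]

lemma localWt_add_eq {ω : ℂ} {p : ℕ} (hω0 : ω ≠ 0) (hωp : ω ^ p = -1) (e : Fin 2) (r : ℕ)
    (t s : Fin 2) : localWt ω p e (r + p) t s =
      (if s = e then Polynomial.C (ω ^ (-2 - (r : ℤ))) * Polynomial.X else 1) *
        (if t = e then 1 else -(Polynomial.C (ω ^ (r : ℤ)) * Polynomial.X)) := by
  rw [localWt, show (p : ℤ) - 2 - (r + p : ℕ) = -2 - r by push_cast; ring, Nat.cast_add,
    zpow_add₀ hω0, zpow_natCast, zpow_natCast, hωp, mul_neg_one, map_neg, neg_mul]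

/-- Amplifications of `coreMat` to windows of `2p - 1` strands shifted by `p` commute. -/
lemma ampMat_coreMat_comm {ω : ℂ} {p : ℕ} (hp : 2 ≤ p) (hω : IsPrimitiveRoot (ω ^ 2) p)
    (hω0 : ω ≠ 0) (hωp : ω ^ p = -1) (e : Fin 2) (n a b : ℕ) (hb : b = a + p) (h : a + (2 * p - 1) ≤ n)
    (h' : b + (2 * p - 1) ≤ n) :
    ampMat n a (2 * p - 1) h (coreMat ω p e (2 * p - 1)) *
        ampMat n b (2 * p - 1) h' (coreMat ω p e (2 * p - 1)) =
      ampMat n b (2 * p - 1) h' (coreMat ω p e (2 * p - 1)) *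
        ampMat n a (2 * p - 1) h (coreMat ω p e (2 * p - 1)) := by
  subst hb
  ext t s
  set κ : ℂ →+* Polynomial (Polynomial ℂ) := Polynomial.C.comp Polynomial.C with hκ
  set x : Polynomial (Polynomial ℂ) := Polynomial.C Polynomial.X with hx
  set y : Polynomial (Polynomial ℂ) := Polynomial.X with hy
  set L : Fin n → Polynomial (Polynomial ℂ) := fun j =>
    ∑ v, Polynomial.C (ampWt ω p e a (2 * p - 1) j (t j) v) *
      (ampWt ω p e (a + p) (2 * p - 1) j v (s j)).map Polynomial.C with hL
  set R : Fin n → Polynomial (Polynomial ℂ) := fun j =>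
    ∑ v, Polynomial.C (ampWt ω p e a (2 * p - 1) j v (s j)) *
      (ampWt ω p e (a + p) (2 * p - 1) j (t j) v).map Polynomial.C with hR
  have hLcoeff : (ampMat n a (2 * p - 1) h (coreMat ω p e (2 * p - 1)) *
        ampMat n (a + p) (2 * p - 1) h' (coreMat ω p e (2 * p - 1))) t s =
      ((∏ j, L j).coeff (p - 1)).coeff (p - 1) := by
    rw [Matrix.mul_apply, hL, ← sum_coeff_mul_coeff_prod]
    simp only [ampMat_coreMat_apply]
  have hRcoeff : (ampMat n (a + p) (2 * p - 1) h' (coreMat ω p e (2 * p - 1)) *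
        ampMat n a (2 * p - 1) h (coreMat ω p e (2 * p - 1))) t s =
      ((∏ j, R j).coeff (p - 1)).coeff (p - 1) := by
    rw [Matrix.mul_apply, hR, ← sum_coeff_mul_coeff_prod]
    simp only [ampMat_coreMat_apply, mul_comm]
  set α : ℕ → Polynomial (Polynomial ℂ) := fun r => κ (ω ^ (-2 - (r : ℤ))) with hα
  set β : ℕ → Polynomial (Polynomial ℂ) := fun r => κ (ω ^ (r : ℤ)) with hβ
  set fL : Fin n → Polynomial (Polynomial ℂ) := fun j =>
    if a + p ≤ (j : ℕ) ∧ (j : ℕ) < a + p + (p - 1) then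
      (if t j = e then 1 else -(β (j - (a + p)) * x)) *
        (if s j = e then -(α (j - (a + p)) * y) else 1) else L j with hfL
  set fR : Fin n → Polynomial (Polynomial ℂ) := fun j =>
    if a + p ≤ (j : ℕ) ∧ (j : ℕ) < a + p + (p - 1) then
      (if t j = e then 1 else β (j - (a + p)) * y) *
        (if s j = e then α (j - (a + p)) * x else 1) else L j with hfR
  have hLj : ∀ j, L j = fL j * if a + p ≤ (j : ℕ) ∧ (j : ℕ) < a + p + (p - 1) then
      α (j - (a + p)) * x + β (j - (a + p)) * y else 1 := by
    intro j
    by_cases hB : a + p ≤ (j : ℕ) ∧ (j : ℕ) < a + p + (p - 1)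
    · have hA : a ≤ (j : ℕ) ∧ (j : ℕ) < a + (2 * p - 1) := by omega
      have hC : a + p ≤ (j : ℕ) ∧ (j : ℕ) < a + p + (2 * p - 1) := by omega
      simp only [hfL, hL, if_pos hB, ampWt, if_pos hA, if_pos hC,
        show (j : ℕ) - a = (j - (a + p)) + p by omega]
      simp only [localWt_add_eq hω0 hωp]
      simp only [localWt_eq hω0 hωp]
      generalize (j : ℕ) - (a + p) = r
      generalize t j = t'
      generalize s j = s'
      simp only [hα, hβ, hκ, RingHom.comp_apply, hx, hy]
      fin_cases e <;> fin_cases t' <;> fin_cases s' <;> simp [Fin.sum_univ_two] <;> ring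
    · simp only [hfL, if_neg hB, mul_one]
  have hRj : ∀ j, R j = fR j * if a + p ≤ (j : ℕ) ∧ (j : ℕ) < a + p + (p - 1) then
      -(α (j - (a + p)) * y + β (j - (a + p)) * x) else 1 := by
    intro j
    by_cases hB : a + p ≤ (j : ℕ) ∧ (j : ℕ) < a + p + (p - 1)
    · have hA : a ≤ (j : ℕ) ∧ (j : ℕ) < a + (2 * p - 1) := by omega
      have hC : a + p ≤ (j : ℕ) ∧ (j : ℕ) < a + p + (2 * p - 1) := by omega
      simp only [hfR, hR, if_pos hB, ampWt, if_pos hA, if_pos hC,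
        show (j : ℕ) - a = (j - (a + p)) + p by omega]
      simp only [localWt_add_eq hω0 hωp]
      simp only [localWt_eq hω0 hωp]
      generalize (j : ℕ) - (a + p) = r
      generalize t j = t'
      generalize s j = s'
      simp only [hα, hβ, hκ, RingHom.comp_apply, hx, hy]
      fin_cases e <;> fin_cases t' <;> fin_cases s' <;> simp [Fin.sum_univ_two] <;> ring
    · simp only [hfR, if_neg hB, mul_one, hL, hR, ampWt]
      generalize t j = t'
      generalize s j = s'
      by_cases hA : a ≤ (j : ℕ) ∧ (j : ℕ) < a + (2 * p - 1)
      · have hC : ¬ (a + p ≤ (j : ℕ) ∧ (j : ℕ) < a + p + (2 * p - 1)) := by omega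
        simp only [if_pos hA, if_neg hC]
        fin_cases t' <;> fin_cases s' <;> simp [Fin.sum_univ_two]
      · simp only [if_neg hA]
        fin_cases t' <;> fin_cases s' <;> simp
  have hwin : ∀ g : ℕ → Polynomial (Polynomial ℂ),
      (∏ j : Fin n, if a + p ≤ (j : ℕ) ∧ (j : ℕ) < a + p + (p - 1) then g (j - (a + p)) else 1) =
        ∏ r ∈ Finset.range (p - 1), g r := by
    intro g
    rw [prod_window n (a + p) (p - 1) (by omega) (fun j => g (j - (a + p))), Finset.prod_range]
    simp
  set P := ∏ r ∈ Finset.range (p - 1), (α r * x + β r * y) with hP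
  have hPR : ∏ r ∈ Finset.range (p - 1), (-(α r * y + β r * x)) = P := by
    rw [hP, ← Finset.prod_range_reflect]
    refine Finset.prod_congr rfl fun r hr => ?_
    have hr' : r < p - 1 := Finset.mem_range.1 hr
    have h1 : α (p - 1 - 1 - r) = -β r := by
      simp only [hα, hβ]
      rw [← map_neg]
      congr 1
      rw [show (-2 - ((p - 1 - 1 - r : ℕ) : ℤ)) = r + -p by omega, zpow_add₀ hω0, zpow_neg,
        zpow_natCast ω p, hωp]
      norm_num
    have h2 : β (p - 1 - 1 - r) = -α r := by
      simp only [hα, hβ]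
      rw [← map_neg]
      congr 1
      rw [show ((p - 1 - 1 - r : ℕ) : ℤ) = (-2 - r) + p by omega, zpow_add₀ hω0,
        zpow_natCast ω p, hωp]
      ring
    rw [h1, h2]
    ring
  have hLprod : ∏ j, L j = (∏ j, fL j) * P := by
    rw [Finset.prod_congr rfl fun j _ => hLj j, Finset.prod_mul_distrib,
      hwin (fun r => α r * x + β r * y)]
  have hRprod : ∏ j, R j = (∏ j, fR j) * P := by
    rw [Finset.prod_congr rfl fun j _ => hRj j, Finset.prod_mul_distrib,
      hwin (fun r => -(α r * y + β r * x)), hPR]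
  have hF : x + y ∣ ∏ j, fL j - ∏ j, fR j := by
    rw [← Ideal.mem_span_singleton, ← Ideal.Quotient.eq, map_prod, map_prod]
    refine Finset.prod_congr rfl fun j _ => ?_
    have hxy : Ideal.Quotient.mk (Ideal.span {x + y}) x =
        -Ideal.Quotient.mk (Ideal.span {x + y}) y := by
      rw [← map_neg, Ideal.Quotient.eq, sub_neg_eq_add]
      exact Ideal.mem_span_singleton_self _
    simp only [hfL, hfR]
    split_ifs <;> simp [hxy]
  have hxyP : (x + y) * P ∈ Ideal.span {x ^ p, y ^ p} := by
    have hm := prod_linear_mem_span κ (by omega : 0 < p) hω hω0 x y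
    obtain ⟨m, rfl⟩ : ∃ m, p = m + 1 := ⟨p - 1, by omega⟩
    rw [Finset.prod_range_succ] at hm
    have hlast : κ (ω ^ (-2 - (m : ℤ))) * x + κ (ω ^ (m : ℤ)) * y = κ (-ω⁻¹) * (x + y) := by
      have hm1 : ω ^ (m : ℤ) = -ω⁻¹ := by
        rw [zpow_natCast, eq_neg_iff_add_eq_zero]
        field_simp
        rw [← pow_succ, hωp]
        ring
      rw [sub_eq_add_neg, zpow_add₀ hω0, zpow_neg _ (m : ℤ), hm1, mul_add]
      congr 3
      rw [zpow_neg]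
      norm_cast
      field_simp
    rw [hlast] at hm
    change P * _ ∈ _ at hm
    have h3 := Ideal.mul_mem_left _ (κ (-ω)) hm
    convert h3 using 1
    have h4 : κ (-ω) * κ (-ω⁻¹) = 1 := by
      rw [← map_mul, neg_mul_neg, mul_inv_cancel₀ hω0, map_one]
    linear_combination (-(x + y) * P) * h4
  rw [hLcoeff, hRcoeff, hLprod, hRprod, ← sub_eq_zero, ← Polynomial.coeff_sub,
    ← Polynomial.coeff_sub, ← sub_mul]
  obtain ⟨G, hG⟩ := hF
  rw [hG, mul_comm (x + y), mul_assoc]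
  exact coeff_coeff_eq_zero_of_mem_span (by omega) (Ideal.mul_mem_left _ G hxyP)

lemma ampMat_smul (n a c : ℕ) (h : a + c ≤ n) (D : ℂ) (M : Matrix (Str c) (Str c) ℂ) :
    ampMat n a c h (D • M) = D • ampMat n a c h M := by
  ext t s
  simp only [ampMat, Matrix.smul_apply]
  split_ifs <;> simp

lemma qfact_mul_qfact {q : ℂ} {p : ℕ} (hq : q ≠ 0) (hqp : q ^ p = -1) {k m : ℕ}
    (hkm : k + m = p - 1) (hp : 0 < p) : qfact q k * qfact q m = qfact q (p - 1) := by
  induction k generalizing m with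
  | zero =>
    rw [zero_add] at hkm
    simp [hkm, qfact]
  | succ k ih =>
    rw [← ih (m := m + 1) (by omega), qfact, qfact, qfact, qfact, Finset.prod_range_succ,
      Finset.prod_range_succ]
    have : qint q ((k : ℤ) + 1) = qint q ((m : ℤ) + 1) := by
      have h1 : q ^ ((m : ℤ) + 1) = -q ^ (-((k : ℤ) + 1)) := by
        rw [show ((m : ℤ) + 1) = p + -((k : ℤ) + 1) by omega, zpow_add₀ hq, zpow_natCast q p, hqp,
          neg_one_mul]
      have h2 : q ^ (-((m : ℤ) + 1)) = -q ^ ((k : ℤ) + 1) := by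
        rw [zpow_neg, h1, inv_neg, ← zpow_neg, neg_neg]
      rw [qint, qint, h1, h2, sub_neg_eq_add, neg_add_eq_sub]
    rw [this]
    ring

lemma Fin.ne_one_iff_eq_zero (x : Fin 2) : x ≠ 1 ↔ x = 0 := by
  revert x; decide

lemma Fin.ne_zero_iff_eq_one (x : Fin 2) : x ≠ 0 ↔ x = 1 := by
  revert x; decide

lemma two_mul_sq_sub_self_ediv (k : ℤ) : 2 * ((k ^ 2 - k) / 2) = k ^ 2 - k := by
  refine Int.mul_ediv_cancel' ?_
  rw [sq, ← mul_sub_one]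
  exact (Int.even_mul_pred_self k).two_dvd

lemma alphaMat_eq_smul_coreMat {q : ℂ} {p : ℕ} (hp : 2 ≤ p) (hq : q ≠ 0) (hq2 : q - q⁻¹ ≠ 0)
    (hqp : q ^ p = -1) : ∃ D : ℂ, alphaMat q p = D • coreMat q p 1 (2 * p - 1) := by
  refine ⟨q ^ (-(2 * (p : ℤ) - 2) * (p - 1) + (((p : ℤ) - 1) ^ 2 - (p - 1)) / 2) *
    qfact q (p - 1), ?_⟩
  ext t s
  rw [Matrix.smul_apply, coreMat_apply hq, alphaMat]
  simp only [EOp_pow_xtop_apply hq hq2, Fin.ne_one_iff_eq_zero, onesOf, posSum, smul_eq_mul]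
  set S := Finset.univ.filter fun j => s j = 1
  set Z := Finset.univ.filter fun j => t j = 0
  by_cases h : S.card + Z.card = p - 1
  · obtain ⟨m, hm⟩ : ∃ m, m = p - 1 - S.card := ⟨_, rfl⟩
    rw [if_pos (by omega), if_pos (by omega), if_pos h, ← hm,
      ← qfact_mul_qfact hq hqp (k := S.card) (m := m) (by omega) (by omega)]
    have hmZ : (Z.card : ℤ) = m := by omega
    have hmk : (m : ℤ) = p - 1 - S.card := by omega
    have hper : q ^ (2 * (p : ℤ) * S.card) = 1 := by
      rw [zpow_mul, mul_comm, zpow_mul, zpow_natCast q p, hqp]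
      norm_num
    have hexp : (S.card : ℤ) * ((2 * p - 1 : ℕ) : ℤ) - ((S.card : ℤ) ^ 2 - S.card) / 2 -
        ∑ j ∈ S, (((j : ℕ) : ℤ) + 1) + ((m : ℤ) ^ 2 - m) / 2 +
        ∑ j ∈ Z, (-(((2 * p - 1 : ℕ) : ℤ) - 1 - (j : ℕ))) =
        -(2 * (p : ℤ) - 2) * (p - 1) + (((p : ℤ) - 1) ^ 2 - (p - 1)) / 2 +
        (((p : ℤ) - 2) * S.card - ∑ j ∈ S, ((j : ℕ) : ℤ) + ∑ j ∈ Z, ((j : ℕ) : ℤ)) +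
        2 * (p : ℤ) * S.card := by
      have e1 := two_mul_sq_sub_self_ediv S.card
      have e2 := two_mul_sq_sub_self_ediv m
      have e3 := two_mul_sq_sub_self_ediv ((p : ℤ) - 1)
      have hz : ((2 * p - 1 : ℕ) : ℤ) = 2 * p - 1 := by omega
      simp only [hz, Finset.sum_add_distrib, Finset.sum_neg_distrib, Finset.sum_sub_distrib,
        Finset.sum_const, nsmul_eq_mul, hmZ]
      rw [hmk] at e2 ⊢
      refine mul_left_cancel₀ (two_ne_zero (α := ℤ)) ?_
      linear_combination -e1 + e2 - e3
    calc _ = q ^ ((S.card : ℤ) * ((2 * p - 1 : ℕ) : ℤ) - ((S.card : ℤ) ^ 2 - S.card) / 2 -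
        ∑ j ∈ S, (((j : ℕ) : ℤ) + 1) + ((m : ℤ) ^ 2 - m) / 2 +
        ∑ j ∈ Z, (-(((2 * p - 1 : ℕ) : ℤ) - 1 - (j : ℕ)))) * (qfact q S.card * qfact q m) := by
          rw [zpow_add₀ hq, zpow_add₀ hq]; ring
      _ = _ := by
          rw [hexp, zpow_add₀ hq, hper, zpow_add₀ hq]; ring
  · rw [if_neg h, mul_zero]
    split_ifs
    · omega
    · rw [mul_zero]
    · rfl

lemma betaMat_eq_smul_coreMat {q : ℂ} {p : ℕ} (hp : 2 ≤ p) (hq : q ≠ 0) (hq2 : q - q⁻¹ ≠ 0)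
    (hqp : q ^ p = -1) : ∃ D : ℂ, betaMat q p = D • coreMat q⁻¹ p 0 (2 * p - 1) := by
  refine ⟨q ^ ((p : ℤ) * (2 * p - 1) - ((p : ℤ) ^ 2 - p) / 2 -
    ∑ j : Fin (2 * p - 1), (((j : ℕ) : ℤ) + 1) + (p - 1) ^ 2) * qfact q (p - 1), ?_⟩
  ext t s
  rw [Matrix.smul_apply, coreMat_apply (inv_ne_zero hq), betaMat]
  simp only [FOp_pow_x0_apply hq hq2, Fin.ne_zero_iff_eq_one, onesOf, posSum, smul_eq_mul]
  have hcompl : (Finset.univ.filter fun j => ¬ s j = 1) = Finset.univ.filter fun j => s j = 0 := by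
    simp only [← ne_eq, Fin.ne_one_iff_eq_zero]
  have hcard := Finset.card_filter_add_card_filter_not (s := Finset.univ) (fun j => s j = 1)
  have hsum := Finset.sum_filter_add_sum_filter_not Finset.univ (fun j => s j = 1)
    (fun j : Fin (2 * p - 1) => ((j : ℕ) : ℤ) + 1)
  rw [hcompl] at hcard hsum
  rw [Finset.card_univ, Fintype.card_fin] at hcard
  set K := Finset.univ.filter fun j => s j = 1
  set S := Finset.univ.filter fun j => s j = 0
  set Z := Finset.univ.filter fun j => t j = 1
  by_cases h : S.card + Z.card = p - 1
  · obtain ⟨m, hm⟩ : ∃ m, m = K.card - p := ⟨_, rfl⟩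
    rw [if_pos (by omega), if_pos (by omega), if_pos h, ← hm,
      ← qfact_mul_qfact hq hqp (k := S.card) (m := m) (by omega) (by omega),
      show 2 * p - 1 - K.card = S.card by omega]
    have hkm : (K.card : ℤ) = m + p := by omega
    have hSm : (S.card : ℤ) = p - 1 - m := by omega
    have hexp : (K.card : ℤ) * ((2 * p - 1 : ℕ) : ℤ) - ((K.card : ℤ) ^ 2 - K.card) / 2 -
        ∑ j ∈ K, (((j : ℕ) : ℤ) + 1) + ((m : ℤ) ^ 2 - m) / 2 + ∑ j ∈ Z, (-((j : ℕ) : ℤ)) =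
        (p : ℤ) * (2 * p - 1) - ((p : ℤ) ^ 2 - p) / 2 -
        ∑ j : Fin (2 * p - 1), (((j : ℕ) : ℤ) + 1) + (p - 1) ^ 2 +
        -(((p : ℤ) - 2) * S.card - ∑ j ∈ S, ((j : ℕ) : ℤ) + ∑ j ∈ Z, ((j : ℕ) : ℤ)) := by
      have e1 := two_mul_sq_sub_self_ediv K.card
      have e2 := two_mul_sq_sub_self_ediv m
      have e3 := two_mul_sq_sub_self_ediv p
      have hz : ((2 * p - 1 : ℕ) : ℤ) = 2 * p - 1 := by omega
      have hS : ∑ j ∈ S, (((j : ℕ) : ℤ) + 1) = ∑ j ∈ S, ((j : ℕ) : ℤ) + S.card := by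
        simp [Finset.sum_add_distrib]
      rw [hS] at hsum
      rw [← hsum, Finset.sum_neg_distrib, hz, hSm]
      rw [hkm] at e1 ⊢
      refine mul_left_cancel₀ (two_ne_zero (α := ℤ)) ?_
      linear_combination -e1 + e2 + e3
    calc _ = q ^ ((K.card : ℤ) * ((2 * p - 1 : ℕ) : ℤ) - ((K.card : ℤ) ^ 2 - K.card) / 2 -
        ∑ j ∈ K, (((j : ℕ) : ℤ) + 1) + ((m : ℤ) ^ 2 - m) / 2 + ∑ j ∈ Z, (-((j : ℕ) : ℤ))) *
          (qfact q S.card * qfact q m) := by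
          rw [zpow_add₀ hq, zpow_add₀ hq]; ring
      _ = _ := by
          rw [hexp, zpow_add₀ hq, inv_zpow']; ring
  · rw [if_neg h, mul_zero]
    split_ifs
    · omega
    · rw [mul_zero]
    · rfl

/-- for `i ≥ 1` with `i + p ≤ n - 2p + 2` (written `i + 3p ≤ n + 2`),
`αᵢ∘α_{i+p} = α_{i+p}∘αᵢ` and `βᵢ∘β_{i+p} = β_{i+p}∘βᵢ` on `V^{⊗n}`. -/
theorem stmt3 (p : ℕ) (hp : 2 ≤ p) (q : ℂ)
    (hq : q = Complex.exp (Real.pi * Complex.I / p))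
    (n : ℕ) (hn : 2 * p - 1 ≤ n)
    (i : ℕ) (hi1 : 1 ≤ i) (hi2 : i + 3 * p ≤ n + 2) :
    alphaOpAt q p n i (by omega) ∘ₗ alphaOpAt q p n (i + p) (by omega)
        = alphaOpAt q p n (i + p) (by omega) ∘ₗ alphaOpAt q p n i (by omega) ∧
      betaOpAt q p n i (by omega) ∘ₗ betaOpAt q p n (i + p) (by omega)
        = betaOpAt q p n (i + p) (by omega) ∘ₗ betaOpAt q p n i (by omega) := by
  have hp0 : (p : ℂ) ≠ 0 := by exact_mod_cast (by omega : p ≠ 0)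
  have hq0 : q ≠ 0 := by rw [hq]; exact Complex.exp_ne_zero _
  have hqp : q ^ p = -1 := by
    rw [hq, ← Complex.exp_nat_mul, mul_div_cancel₀ _ hp0, Complex.exp_pi_mul_I]
  have hprim : IsPrimitiveRoot (q ^ 2) p := by
    have h := Complex.isPrimitiveRoot_exp p (by omega)
    rw [hq, ← Complex.exp_nat_mul]
    convert h using 2
    push_cast
    ring
  have hq2 : q - q⁻¹ ≠ 0 := by
    intro h
    apply hprim.ne_one (by omega)
    rw [sq]
    nth_rewrite 1 [sub_eq_zero.1 h]
    exact inv_mul_cancel₀ hq0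
  obtain ⟨D, hD⟩ := alphaMat_eq_smul_coreMat hp hq0 hq2 hqp
  obtain ⟨D', hD'⟩ := betaMat_eq_smul_coreMat hp hq0 hq2 hqp
  constructor
  · simp only [alphaOpAt, hD, ampMat_smul, ← Matrix.mulVecLin_mul, Matrix.smul_mul,
      Matrix.mul_smul]
    rw [ampMat_coreMat_comm hp hprim hq0 hqp 1 n (i - 1) (i + p - 1) (by omega)]
  · simp only [betaOpAt, hD', ampMat_smul, ← Matrix.mulVecLin_mul, Matrix.smul_mul,
      Matrix.mul_smul]
    rw [ampMat_coreMat_comm hp (by rw [inv_pow]; exact hprim.inv) (inv_ne_zero hq0)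
      (by rw [inv_pow, hqp]; norm_num) 0 n (i - 1) (i + p - 1) (by omega)]

end
end

section
/- Let α, β be the operators on V^⊗(2p−1) defined in the context. For all 1 ≤ i ≤ 2p−2, one has α∘∩_i = 0 and β∘∩_i = 0 as maps V^⊗(2p−3) → V^⊗(2p−1), and ∪_i∘α = 0 and ∪_i∘β = 0 as maps V^⊗(2p−1) → V^⊗(2p−3). -/
noncomputable section

section

open Equiv

/-- `v` satisfies `v(…10…) = q · v(…01…)` for the entries of strings at two given
positions. -/
def QSymmAt {z : ℕ} (q : ℂ) (i i' : Fin z) (v : Vz z) : Prop :=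
  ∀ t : Str z, t i = 1 → t i' = 0 → v t = q * v (t ∘ swap i i')

variable {z : ℕ} {q : ℂ} {i i' : Fin z}

lemma swap_lt_swap_iff (hii : (i' : ℕ) = i + 1) {j : Fin z} (hj : j ≠ i) (hj' : j ≠ i')
    (l : Fin z) : swap i i' j < swap i i' l ↔ j < l := by
  rw [swap_apply_of_ne_of_ne hj hj']
  rw [Ne, Fin.ext_iff] at hj hj'
  rcases eq_or_ne l i with rfl | hl
  · rw [swap_apply_left]; simp only [Fin.lt_def]; omega
  rcases eq_or_ne l i' with rfl | hl'
  · rw [swap_apply_right]; simp only [Fin.lt_def]; omega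
  rw [swap_apply_of_ne_of_ne hl hl']

lemma swap_lt_swap_iff' (hii : (i' : ℕ) = i + 1) {j : Fin z} (hj : j ≠ i) (hj' : j ≠ i')
    (l : Fin z) : swap i i' l < swap i i' j ↔ l < j := by
  rw [swap_apply_of_ne_of_ne hj hj']
  rw [Ne, Fin.ext_iff] at hj hj'
  rcases eq_or_ne l i with rfl | hl
  · rw [swap_apply_left]; simp only [Fin.lt_def]; omega
  rcases eq_or_ne l i' with rfl | hl'
  · rw [swap_apply_right]; simp only [Fin.lt_def]; omega
  rw [swap_apply_of_ne_of_ne hl hl']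

lemma sum_filter_comp_swap (i i' : Fin z) (P : Fin z → Prop) [DecidablePred P] (t : Str z) :
    ∑ l ∈ Finset.univ.filter P, kwt ((t ∘ swap i i') l) =
      ∑ l ∈ Finset.univ.filter (fun l => P (swap i i' l)), kwt (t l) := by
  rw [Finset.sum_filter, Finset.sum_filter,
    ← Equiv.sum_comp (swap i i') (fun l => if P l then kwt ((t ∘ swap i i') l) else 0)]
  simp

lemma update_comp_swap (i i' j : Fin z) (t : Str z) (b : Fin 2) :
    Function.update t j b ∘ swap i i' = Function.update (t ∘ swap i i') (swap i i' j) b := by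
  rw [Function.update_comp_equiv, symm_swap]

lemma comp_swap_eq_self {t : Str z} (h : t i = t i') : t ∘ swap i i' = t := by
  funext l
  rcases eq_or_ne l i with rfl | hl
  · simp [h]
  rcases eq_or_ne l i' with rfl | hl'
  · simp [h]
  simp [swap_apply_of_ne_of_ne hl hl']

/-- The weight with which `E_z` sends the string obtained from `t` by raising position `j`
to `t`. -/
def eCoeff (q : ℂ) (j : Fin z) (t : Str z) : ℂ :=
  if t j = 0 then q ^ (∑ l ∈ Finset.univ.filter (fun l => j < l), kwt (t l)) else 0

/-- The weight with which `F_z` sends the string obtained from `t` by lowering position `j`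
to `t`. -/
def fCoeff (q : ℂ) (j : Fin z) (t : Str z) : ℂ :=
  if t j = 1 then q ^ (-∑ l ∈ Finset.univ.filter (fun l => l < j), kwt (t l)) else 0

lemma eq_update_iff {a b : Fin 2} (s t : Str z) (j : Fin z) :
    s j = b ∧ t = Function.update s j a ↔ t j = a ∧ s = Function.update t j b := by
  constructor <;> rintro ⟨h, rfl⟩ <;> simp [← h]

lemma EOp_apply (v : Vz z) (t : Str z) :
    EOp q z v t = ∑ j, eCoeff q j t * v (Function.update t j 1) := by
  simp only [EOp, Matrix.mulVecLin_apply, Matrix.mulVec, dotProduct, Emat, Finset.sum_mul]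
  rw [Finset.sum_comm]
  refine Finset.sum_congr rfl fun j _ => ?_
  rw [Finset.sum_eq_single (Function.update t j 1)]
  · rw [eCoeff]
    simp only [eq_update_iff (a := 0) (b := 1), and_true]
    congr 2
    refine congrArg _ (Finset.sum_congr rfl fun l hl => ?_)
    rw [Function.update_of_ne (Finset.mem_filter.mp hl).2.ne']
  · intro s _ hs
    rw [if_neg, zero_mul]
    rw [eq_update_iff (a := 0) (b := 1)]
    exact fun h => hs h.2
  · simp

lemma FOp_apply (v : Vz z) (t : Str z) :
    FOp q z v t = ∑ j, fCoeff q j t * v (Function.update t j 0) := by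
  simp only [FOp, Matrix.mulVecLin_apply, Matrix.mulVec, dotProduct, Fmat, Finset.sum_mul]
  rw [Finset.sum_comm]
  refine Finset.sum_congr rfl fun j _ => ?_
  rw [Finset.sum_eq_single (Function.update t j 0)]
  · rw [fCoeff]
    simp only [eq_update_iff (a := 1) (b := 0), and_true]
    congr 2
    refine congrArg _ (congrArg _ (Finset.sum_congr rfl fun l hl => ?_))
    rw [Function.update_of_ne (Finset.mem_filter.mp hl).2.ne]
  · intro s _ hs
    rw [if_neg, zero_mul]
    rw [eq_update_iff (a := 1) (b := 0)]
    exact fun h => hs h.2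
  · simp

lemma QSymmAt.EOp (hq : q ≠ 0) (hii : (i' : ℕ) = i + 1) {v : Vz z} (hv : QSymmAt q i i' v) :
    QSymmAt q i i' (EOp q z v) := by
  intro t h1 h0
  have hne : i ≠ i' := fun h => by rw [h] at hii; omega
  rw [EOp_apply, EOp_apply,
    ← Equiv.sum_comp (swap i i') (fun j => eCoeff q j (t ∘ _) * _), Finset.mul_sum]
  refine Finset.sum_congr rfl fun j _ => ?_
  rw [← update_comp_swap]
  simp only [eCoeff, Function.comp_apply, swap_apply_self]
  split_ifs with hj
  swap
  · simp
  have hji : j ≠ i := by rintro rfl; simp [h1] at hj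
  have hs := sum_filter_comp_swap i i' (fun l => swap i i' j < l) t
  simp only [Function.comp_apply] at hs
  rw [hs]
  rcases eq_or_ne j i' with rfl | hji'
  · have hset : Finset.univ.filter (fun l => swap i j j < swap i j l) =
        insert i (Finset.univ.filter fun l => j < l) := by
      ext l
      rw [swap_apply_right]
      rcases eq_or_ne l i with rfl | hl
      · simp only [swap_apply_left, Finset.mem_filter, Finset.mem_univ, true_and,
          Finset.mem_insert, Fin.lt_def, true_or, iff_true]
        omega
      rcases eq_or_ne l j with rfl | hl'
      · simp only [swap_apply_right, Finset.mem_filter, Finset.mem_univ, true_and,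
          Finset.mem_insert, Fin.lt_def, Fin.ext_iff]
        omega
      rw [Ne, Fin.ext_iff] at hl hl'
      simp only [swap_apply_of_ne_of_ne (Fin.ne_of_val_ne hl) (Fin.ne_of_val_ne hl'),
        Finset.mem_filter, Finset.mem_univ, true_and, Finset.mem_insert, Fin.lt_def, Fin.ext_iff]
      omega
    rw [hset, Finset.sum_insert (by simp [Fin.le_def, hii]), h1, zpow_add₀ hq,
      comp_swap_eq_self (by simp [hne, h1])]
    simp only [kwt, one_ne_zero, if_false, zpow_neg_one]
    field_simp
  · simp only [swap_lt_swap_iff hii hji hji']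
    rw [hv (Function.update t j 1) (by simp [hji.symm, h1]) (by simp [hji'.symm, h0])]
    ring

lemma QSymmAt.FOp (hq : q ≠ 0) (hii : (i' : ℕ) = i + 1) {v : Vz z} (hv : QSymmAt q i i' v) :
    QSymmAt q i i' (FOp q z v) := by
  intro t h1 h0
  have hne : i ≠ i' := fun h => by rw [h] at hii; omega
  rw [FOp_apply, FOp_apply,
    ← Equiv.sum_comp (swap i i') (fun j => fCoeff q j (t ∘ _) * _), Finset.mul_sum]
  refine Finset.sum_congr rfl fun j _ => ?_
  rw [← update_comp_swap]
  simp only [fCoeff, Function.comp_apply, swap_apply_self]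
  split_ifs with hj
  swap
  · simp
  have hji' : j ≠ i' := by rintro rfl; simp [h0] at hj
  have hs := sum_filter_comp_swap i i' (fun l => l < swap i i' j) t
  simp only [Function.comp_apply] at hs
  rw [hs]
  rcases eq_or_ne j i with rfl | hji
  · have hset : Finset.univ.filter (fun l => swap j i' l < swap j i' j) =
        insert i' (Finset.univ.filter fun l => l < j) := by
      ext l
      rw [swap_apply_left]
      rcases eq_or_ne l i' with rfl | hl
      · simp only [swap_apply_right, Finset.mem_filter, Finset.mem_univ, true_and,
          Finset.mem_insert, Fin.lt_def, true_or, iff_true]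
        omega
      rcases eq_or_ne l j with rfl | hl'
      · simp only [swap_apply_left, Finset.mem_filter, Finset.mem_univ, true_and,
          Finset.mem_insert, Fin.lt_def, Fin.ext_iff]
        omega
      rw [Ne, Fin.ext_iff] at hl hl'
      simp only [swap_apply_of_ne_of_ne (Fin.ne_of_val_ne hl') (Fin.ne_of_val_ne hl),
        Finset.mem_filter, Finset.mem_univ, true_and, Finset.mem_insert, Fin.lt_def, Fin.ext_iff]
      omega
    rw [hset, Finset.sum_insert (by simp [Fin.le_def, hii]), h0, neg_add, zpow_add₀ hq,
      comp_swap_eq_self (by simp [hne.symm, h0])]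
    simp only [kwt, if_true, zpow_neg_one]
    field_simp
  · simp only [swap_lt_swap_iff' hii hji hji']
    rw [hv (Function.update t j 0) (by simp [hji.symm, h1]) (by simp [hji'.symm, h0])]
    ring

lemma qSymmAt_xtop : QSymmAt q i i' (xtop z) := by
  intro t h1 h0
  have h (s : Str z) (l : Fin z) (hl : s l = 0) : xtop z s = 0 :=
    if_neg fun hs => by simp [hs] at hl
  rw [h t i' h0, h _ i (by simp [h0]), mul_zero]

lemma qSymmAt_x0 : QSymmAt q i i' (x0 z) := by
  intro t h1 h0
  have h (s : Str z) (l : Fin z) (hl : s l = 1) : x0 z s = 0 :=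
    if_neg fun hs => by simp [hs] at hl
  rw [h t i h1, h _ i' (by simp [h1]), mul_zero]

lemma qSymmAt_EOp_pow_xtop (hq : q ≠ 0) (hii : (i' : ℕ) = i + 1) (m : ℕ) :
    QSymmAt q i i' ((EOp q z ^ m) (xtop z)) := by
  induction m with
  | zero => exact qSymmAt_xtop
  | succ m ih => rw [pow_succ', Module.End.mul_apply]; exact ih.EOp hq hii

lemma qSymmAt_FOp_pow_x0 (hq : q ≠ 0) (hii : (i' : ℕ) = i + 1) (m : ℕ) :
    QSymmAt q i i' ((FOp q z ^ m) (x0 z)) := by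
  induction m with
  | zero => exact qSymmAt_x0
  | succ m ih => rw [pow_succ', Module.End.mul_apply]; exact ih.FOp hq hii

lemma card_onesOf_comp (t : Str z) (σ : Perm (Fin z)) :
    (onesOf (t ∘ σ)).card = (onesOf t).card := by
  simp only [onesOf, Finset.card_filter, Function.comp_apply]
  exact Equiv.sum_comp σ fun l => if t l = 1 then 1 else 0

lemma posSum_onesOf_comp_swap (hii : (i' : ℕ) = i + 1) {t : Str z} (h1 : t i = 1)
    (h0 : t i' = 0) : posSum (onesOf (t ∘ swap i i')) = posSum (onesOf t) + 1 := by
  simp only [posSum, onesOf, Finset.sum_filter]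
  rw [← Equiv.sum_comp (swap i i'), ← sub_eq_iff_eq_add', ← Finset.sum_sub_distrib,
    Finset.sum_eq_single i]
  · simp [h1, hii]
  · intro l _ hl
    rcases eq_or_ne l i' with rfl | hl'
    · simp [h0]
    · simp [swap_apply_of_ne_of_ne hl hl']
  · simp

lemma QSymmAt.sum_mul_eq_zero {v : Vz z} (hv : QSymmAt q i i' v) {C : Str z → Prop}
    [DecidablePred C] (hC : ∀ s, C (s ∘ swap i i') ↔ C s) {a b : ℂ} (hab : a * q + b = 0) :
    ∑ s, (if C s then (if s i = 1 ∧ s i' = 0 then a else if s i = 0 ∧ s i' = 1 then b else 0)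
      else 0) * v s = 0 := by
  set f : Str z → ℂ := fun s => (if C s then
    (if s i = 1 ∧ s i' = 0 then a else if s i = 0 ∧ s i' = 1 then b else 0) else 0) * v s with hf
  have key (s : Str z) (h1 : s i = 1) (h0 : s i' = 0) : f s + f (s ∘ swap i i') = 0 := by
    simp only [hf, hC, Function.comp_apply, swap_apply_left, swap_apply_right, h1, h0, and_self,
      zero_ne_one, one_ne_zero, if_true, if_false]
    split_ifs
    swap
    · simp
    rw [hv s h1 h0]
    linear_combination v (s ∘ swap i i') * hab
  have hinv (s : Str z) : (s ∘ swap i i') ∘ swap i i' = s := by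
    funext l; simp
  have hpair (s : Str z) : f s + f (s ∘ swap i i') = 0 := by
    rcases Fin.exists_fin_two.mp ⟨s i, Eq.refl (s i)⟩ with hi | hi <;>
      rcases Fin.exists_fin_two.mp ⟨s i', Eq.refl (s i')⟩ with hi' | hi'
    · simp [hf, hi, hi']
    · have := key (s ∘ swap i i') (by simp [hi']) (by simp [hi])
      rwa [hinv, add_comm] at this
    · exact key s hi hi'
    · simp [hf, hi, hi']
  have hsum : ∑ s, f (s ∘ swap i i') = ∑ s, f s :=
    Equiv.sum_comp (Equiv.arrowCongr (swap i i') (Equiv.refl (Fin 2))) f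
  have h2 : ∑ s, f s + ∑ s, f s = 0 := by
    nth_rw 2 [← hsum]
    rw [← Finset.sum_add_distrib]
    exact Finset.sum_eq_zero fun s _ => hpair s
  exact self_eq_neg.mp (eq_neg_of_add_eq_zero_left h2)

end

section

open Equiv

variable {q : ℂ} {N M i : ℕ}

lemma comp_swap_skip (hi : i + 1 < N) (s : Str N) (j : ℕ)
    (hj : (if j < i then j else j + 2) < N) :
    (s ∘ swap ⟨i, by omega⟩ ⟨i + 1, hi⟩) ⟨if j < i then j else j + 2, hj⟩ =
      s ⟨if j < i then j else j + 2, hj⟩ := by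
  rw [Function.comp_apply, swap_apply_of_ne_of_ne] <;> rw [Ne, Fin.mk.injEq] <;> split_ifs <;> omega

lemma cupMat_mul_eq_zero (h : N = M + 2) (hi : i + 1 < N) {A : Matrix (Str N) (Str N) ℂ}
    (hA : ∀ u, QSymmAt q ⟨i, by omega⟩ ⟨i + 1, hi⟩ fun s => A s u) :
    cupMat q N M i h hi * A = 0 := by
  ext t u
  refine (hA u).sum_mul_eq_zero (a := 1) (b := -q) (fun s => ?_) (by ring)
  simp only [comp_swap_skip hi]

lemma mul_capMat_eq_zero (hq : q ≠ 0) (h : N = M + 2) (hi : i + 1 < N)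
    {A : Matrix (Str N) (Str N) ℂ} (hA : ∀ t, QSymmAt q ⟨i, by omega⟩ ⟨i + 1, hi⟩ (A t)) :
    A * capMat q N M i h hi = 0 := by
  ext t u
  rw [Matrix.mul_apply]
  simp only [mul_comm (A t _)]
  refine (hA t).sum_mul_eq_zero (a := q⁻¹) (b := -1) (fun s => ?_) (by field_simp; ring)
  simp only [comp_swap_skip hi]

end

section

variable {q : ℂ} {p : ℕ} {i i' : Fin (2 * p - 1)}

lemma QSymmAt.const_mul {z : ℕ} {i i' : Fin z} {v : Vz z} (hv : QSymmAt q i i' v) (c : ℂ) :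
    QSymmAt q i i' fun s => c * v s := by
  intro t h1 h0
  simp only [hv t h1 h0]
  ring

lemma qSymmAt_zpow_posSum {z : ℕ} {i i' : Fin z} (hq : q ≠ 0) (hii : (i' : ℕ) = i + 1)
    (e : ℕ → ℤ) (g : ℕ → ℂ) (P : ℕ → Prop) [DecidablePred P] (x : ℕ → ℂ) :
    QSymmAt q i i' fun s => if P (onesOf s).card then
      q ^ (e (onesOf s).card - posSum (onesOf s)) * g (onesOf s).card * x (onesOf s).card
      else 0 := by
  intro t h1 h0
  simp only [card_onesOf_comp, posSum_onesOf_comp_swap hii h1 h0]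
  split_ifs
  · rw [← sub_sub, zpow_sub_one₀ hq]
    field_simp
  · simp

lemma qSymmAt_alphaMat_row (hq : q ≠ 0) (hii : (i' : ℕ) = i + 1) (t : Str (2 * p - 1)) :
    QSymmAt q i i' (alphaMat q p t) :=
  qSymmAt_zpow_posSum hq hii
    (fun k => (k : ℤ) * ((2 * p - 1 : ℕ) : ℤ) - ((k : ℤ) ^ 2 - (k : ℤ)) / 2) (qfact q) (· < p)
    fun k => (EOp q (2 * p - 1) ^ (p - 1 - k)) (xtop (2 * p - 1)) t

lemma qSymmAt_betaMat_row (hq : q ≠ 0) (hii : (i' : ℕ) = i + 1) (t : Str (2 * p - 1)) :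
    QSymmAt q i i' (betaMat q p t) :=
  qSymmAt_zpow_posSum hq hii
    (fun k => (k : ℤ) * ((2 * p - 1 : ℕ) : ℤ) - ((k : ℤ) ^ 2 - (k : ℤ)) / 2)
    (fun k => qfact q (2 * p - 1 - k)) (p ≤ ·)
    fun k => (FOp q (2 * p - 1) ^ (k - p)) (x0 (2 * p - 1)) t

lemma qSymmAt_alphaMat_col (hq : q ≠ 0) (hii : (i' : ℕ) = i + 1) (u : Str (2 * p - 1)) :
    QSymmAt q i i' fun s => alphaMat q p s u := by
  by_cases hk : (onesOf u).card < p
  · simp only [alphaMat, if_pos hk]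
    exact (qSymmAt_EOp_pow_xtop hq hii _).const_mul _
  · simp only [alphaMat, if_neg hk]
    intro t _ _
    simp

lemma qSymmAt_betaMat_col (hq : q ≠ 0) (hii : (i' : ℕ) = i + 1) (u : Str (2 * p - 1)) :
    QSymmAt q i i' fun s => betaMat q p s u := by
  by_cases hk : p ≤ (onesOf u).card
  · simp only [betaMat, if_pos hk]
    exact (qSymmAt_FOp_pow_x0 hq hii _).const_mul _
  · simp only [betaMat, if_neg hk]
    intro t _ _
    simp

end

/-- for `1 ≤ i ≤ 2p - 2`, `α∘∩ᵢ = β∘∩ᵢ = 0 : V^{⊗(2p-3)} → V^{⊗(2p-1)}`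
and `∪ᵢ∘α = ∪ᵢ∘β = 0 : V^{⊗(2p-1)} → V^{⊗(2p-3)}` (positions are passed 0-indexed
as `i - 1`). -/
theorem stmt4 (p : ℕ) (hp : 2 ≤ p) (q : ℂ)
    (hq : q = Complex.exp (Real.pi * Complex.I / p))
    (i : ℕ) (hi1 : 1 ≤ i) (hi2 : i ≤ 2 * p - 2) :
    alphaOp q p ∘ₗ capOp q (2 * p - 1) (2 * p - 3) (i - 1) (by omega) (by omega) = 0 ∧
      betaOp q p ∘ₗ capOp q (2 * p - 1) (2 * p - 3) (i - 1) (by omega) (by omega) = 0 ∧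
      cupOp q (2 * p - 1) (2 * p - 3) (i - 1) (by omega) (by omega) ∘ₗ alphaOp q p = 0 ∧
      cupOp q (2 * p - 1) (2 * p - 3) (i - 1) (by omega) (by omega) ∘ₗ betaOp q p = 0 := by
  have hq0 : q ≠ 0 := hq ▸ Complex.exp_ne_zero _
  simp only [alphaOp, betaOp, capOp, cupOp, ← Matrix.mulVecLin_mul]
  refine ⟨?_, ?_, ?_, ?_⟩
  · rw [mul_capMat_eq_zero hq0 _ _ (qSymmAt_alphaMat_row hq0 rfl), Matrix.mulVecLin_zero]
  · rw [mul_capMat_eq_zero hq0 _ _ (qSymmAt_betaMat_row hq0 rfl), Matrix.mulVecLin_zero]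
  · rw [cupMat_mul_eq_zero _ _ (qSymmAt_alphaMat_col hq0 rfl), Matrix.mulVecLin_zero]
  · rw [cupMat_mul_eq_zero _ _ (qSymmAt_betaMat_col hq0 rfl), Matrix.mulVecLin_zero]

end
end
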